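/- Let i, j ∈ {1, 2} and l ∈ {1, 2}. Let g : ℝ² → ℝ be measurable with ‖g‖_{L²_{uloc}} < ∞, let ρ : ℝ² → ℝ be smooth with ∫_{ℝ²} (1+‖y‖²)² |∂^α ρ(y)|² dy < ∞ for every multi-index α with |α| ≤ 3, and let φ ∈ C_c^∞(ℝ²; ℝ). Then ∫_{ℝ²} ∂_l φ(x) · I_1^{ij}(ρ∗g)(x) dx = − ∫_{ℝ²} φ(x) · I_1^{ij}((∂_l ρ)∗g)(x) dx; that is, the distributional gradient of I_1^{ij}(ρ∗g) equals I_1^{ij}(∇ρ∗g). -/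

import Mathlib

open MeasureTheory

/-- The kernel `γ_{ij}(z) = δ_{ij}/‖z‖³ − 3 z_i z_j/‖z‖⁵` on `ℝ²`. -/
noncomputable def gam (i j : Fin 2) (z : EuclideanSpace ℝ (Fin 2)) : ℝ :=
  (if i = j then (1 : ℝ) else 0) / ‖z‖ ^ 3 - 3 * z i * z j / ‖z‖ ^ 5

/-- The singular integral operator `I_1^{ij}` with cutoff `K = 1`. -/
noncomputable def Iop (i j : Fin 2) (f : EuclideanSpace ℝ (Fin 2) → ℝ)
    (x : EuclideanSpace ℝ (Fin 2)) : ℝ :=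
  ∫ y, gam i j (x - y) *
    (f x - f y - (if ‖x - y‖ ≤ 1 then fderiv ℝ f x (x - y) else 0))

/-- The unit square `k + [0,1]²`. -/
def unitSquare (k : Fin 2 → ℤ) : Set (EuclideanSpace ℝ (Fin 2)) :=
  {x | ∀ i, (k i : ℝ) ≤ x i ∧ x i ≤ k i + 1}

/-- The weighted `L²` condition with weight `(1 + ‖y‖²)²`. -/
def WeightedSq {V : Type*} [NormedAddCommGroup V] (r : EuclideanSpace ℝ (Fin 2) → V) : Prop :=
  Integrable (fun y => (1 + ‖y‖ ^ 2) ^ 2 * ‖r y‖ ^ 2)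

/-- The convolution of a vector-valued function `r` with a scalar function `g`. -/
noncomputable def vconv {V : Type*} [NormedAddCommGroup V] [NormedSpace ℝ V]
    (g : EuclideanSpace ℝ (Fin 2) → ℝ) (r : EuclideanSpace ℝ (Fin 2) → V)
    (z : EuclideanSpace ℝ (Fin 2)) : V :=
  ∫ y, g y • r (z - y)

theorem continuous_of_norm_add_sub_le {E V : Type*} [NormedAddCommGroup E]
    [NormedAddCommGroup V] {f : E → V} {L : ℝ} (hL0 : 0 ≤ L)
    (hL : ∀ x h, ‖f (x + h) - f x‖ ≤ L * ‖h‖) : Continuous f :=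
  (LipschitzWith.of_dist_le_mul (K := L.toNNReal) fun a b => by
    rw [dist_eq_norm, dist_eq_norm, Real.coe_toNNReal _ hL0]
    simpa using hL b (a - b)).continuous

theorem weightedSq_fderiv_fderiv {V : Type*} [NormedAddCommGroup V] [NormedSpace ℝ V]
    {r : EuclideanSpace ℝ (Fin 2) → V}
    (h : Integrable fun y => (1 + ‖y‖ ^ 2) ^ 2 * ‖iteratedFDeriv ℝ 2 r y‖ ^ 2) :
    WeightedSq (fderiv ℝ (fderiv ℝ r)) := by
  simpa only [WeightedSq, ← norm_iteratedFDeriv_fderiv, norm_iteratedFDeriv_zero] using h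

theorem measurableSet_unitSquare (k : Fin 2 → ℤ) : MeasurableSet (unitSquare k) := by
  have : unitSquare k = ⋂ i, {x : EuclideanSpace ℝ (Fin 2) | (k i : ℝ) ≤ x i ∧ x i ≤ k i + 1} := by
    ext x; simp [unitSquare]
  rw [this]
  refine MeasurableSet.iInter fun i => ?_
  have hc : Continuous fun x : EuclideanSpace ℝ (Fin 2) => x i := by fun_prop
  exact ((isClosed_le continuous_const hc).inter
    (isClosed_le hc continuous_const)).measurableSet

theorem iUnion_unitSquare : ⋃ k, unitSquare k = Set.univ := by
  refine Set.eq_univ_of_forall fun x => Set.mem_iUnion.2 ⟨fun i => ⌊x i⌋, fun i => ?_⟩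
  exact ⟨Int.floor_le _, (Int.lt_floor_add_one _).le⟩

theorem summable_inv_one_add_sq_int : Summable fun n : ℤ => (1 + (n : ℝ) ^ 2)⁻¹ := by
  have h := Real.summable_one_div_int_pow.2 (one_lt_two)
  refine Summable.of_norm_bounded_eventually h ?_
  rw [Filter.eventually_cofinite]
  refine (Set.finite_singleton (0 : ℤ)).subset fun n hn => ?_
  by_contra h0
  refine hn ?_
  have h1 : (0 : ℝ) < (n : ℝ) ^ 2 := by
    have : (n : ℝ) ≠ 0 := by exact_mod_cast h0
    positivity
  rw [Real.norm_of_nonneg (by positivity), one_div]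
  exact inv_anti₀ h1 (by linarith)

theorem one_add_sq_floor_le {a b : ℝ} {k : ℤ} (h : (k : ℝ) ≤ b ∧ b ≤ k + 1) :
    1 + ((k - ⌊a⌋ : ℤ) : ℝ) ^ 2 ≤ 3 * (1 + (a - b) ^ 2) := by
  have h1 := Int.floor_le a
  have h2 := (Int.lt_floor_add_one a).le
  push_cast
  have h3 : ((k : ℝ) - ⌊a⌋ + (a - b)) ^ 2 ≤ 1 := by
    rw [sq_le_one_iff_abs_le_one, abs_le]; constructor <;> linarith [h.1, h.2]
  nlinarith [sq_nonneg ((k : ℝ) - ⌊a⌋ + 2 * (a - b))]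

theorem inv_weight_le {z y : EuclideanSpace ℝ (Fin 2)} {k : Fin 2 → ℤ} (hy : y ∈ unitSquare k) :
    ((1 + ‖z - y‖ ^ 2) ^ 2)⁻¹ ≤
      9 * ((1 + ((k 0 - ⌊z 0⌋ : ℤ) : ℝ) ^ 2)⁻¹ * (1 + ((k 1 - ⌊z 1⌋ : ℤ) : ℝ) ^ 2)⁻¹) := by
  have h0 := one_add_sq_floor_le (a := z 0) (hy 0)
  have h1 := one_add_sq_floor_le (a := z 1) (hy 1)
  have hn : ‖z - y‖ ^ 2 = (z 0 - y 0) ^ 2 + (z 1 - y 1) ^ 2 := by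
    simp [EuclideanSpace.norm_sq_eq]
  set A := 1 + ((k 0 - ⌊z 0⌋ : ℤ) : ℝ) ^ 2
  set B := 1 + ((k 1 - ⌊z 1⌋ : ℤ) : ℝ) ^ 2
  have hA : 0 < A := by positivity
  have hB : 0 < B := by positivity
  have hAB : A * B ≤ 9 * (1 + ‖z - y‖ ^ 2) ^ 2 := by
    calc A * B ≤ (3 * (1 + ‖z - y‖ ^ 2)) * (3 * (1 + ‖z - y‖ ^ 2)) := by
          apply mul_le_mul _ _ hB.le (by positivity) <;>
          nlinarith [sq_nonneg (z 0 - y 0), sq_nonneg (z 1 - y 1)]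
      _ = _ := by ring
  rw [← mul_inv, ← div_eq_mul_inv, inv_eq_one_div, div_le_div_iff₀ (by positivity) (by positivity)]
  linarith

theorem exists_lintegral_inv_weight_le (g : EuclideanSpace ℝ (Fin 2) → ℝ)
    (hgu : ∃ M : ℝ, ∀ k : Fin 2 → ℤ,
      ∫⁻ x in unitSquare k, ENNReal.ofReal (g x ^ 2) ≤ ENNReal.ofReal M)
    (hg : Measurable g) :
    ∃ K : ENNReal, K ≠ ⊤ ∧ ∀ z,
      ∫⁻ y, ENNReal.ofReal (((1 + ‖z - y‖ ^ 2) ^ 2)⁻¹ * g y ^ 2) ≤ K := by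
  obtain ⟨M, hM⟩ := hgu
  let c : ℤ → ENNReal := fun n => ENNReal.ofReal ((1 + (n : ℝ) ^ 2)⁻¹)
  have hc : ∑' n, c n ≠ ⊤ := summable_inv_one_add_sq_int.tsum_ofReal_ne_top
  refine ⟨ENNReal.ofReal 9 * ((∑' n, c n) * ∑' n, c n) * ENNReal.ofReal M, by finiteness,
    fun z => ?_⟩
  calc ∫⁻ y, ENNReal.ofReal (((1 + ‖z - y‖ ^ 2) ^ 2)⁻¹ * g y ^ 2)
      ≤ ∑' k, ∫⁻ y in unitSquare k, ENNReal.ofReal (((1 + ‖z - y‖ ^ 2) ^ 2)⁻¹ * g y ^ 2) := by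
        rw [← setLIntegral_univ, ← iUnion_unitSquare]
        exact lintegral_iUnion_le _ _
    _ ≤ ∑' k : Fin 2 → ℤ, ENNReal.ofReal 9 * (c (k 0 - ⌊z 0⌋) * c (k 1 - ⌊z 1⌋)) *
          ENNReal.ofReal M := by
        refine ENNReal.tsum_le_tsum fun k => ?_
        calc _ ≤ ∫⁻ y in unitSquare k, ENNReal.ofReal 9 * (c (k 0 - ⌊z 0⌋) * c (k 1 - ⌊z 1⌋)) *
              ENNReal.ofReal (g y ^ 2) := by
              refine setLIntegral_mono' (measurableSet_unitSquare k) fun y hy => ?_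
              simp only [c]
              rw [← ENNReal.ofReal_mul (by positivity), ← ENNReal.ofReal_mul (by positivity),
                ← ENNReal.ofReal_mul (by positivity)]
              exact ENNReal.ofReal_le_ofReal
                (mul_le_mul_of_nonneg_right (inv_weight_le hy) (sq_nonneg _))
          _ = ENNReal.ofReal 9 * (c (k 0 - ⌊z 0⌋) * c (k 1 - ⌊z 1⌋)) *
              ∫⁻ y in unitSquare k, ENNReal.ofReal (g y ^ 2) :=
              lintegral_const_mul _ (by fun_prop)
          _ ≤ _ := by gcongr; exact hM k
    _ = _ := by
        rw [ENNReal.tsum_mul_right, ENNReal.tsum_mul_left,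
          ← (finTwoArrowEquiv ℤ).symm.tsum_eq]
        simp only [finTwoArrowEquiv_symm_apply, Matrix.cons_val_zero, Matrix.cons_val_one]
        rw [ENNReal.tsum_prod (f := fun a b => c (a - ⌊z 0⌋) * c (b - ⌊z 1⌋))]
        simp_rw [ENNReal.tsum_mul_left, ENNReal.tsum_mul_right]
        congr 3
        · exact (Equiv.subRight ⌊z 0⌋).tsum_eq c
        · exact (Equiv.subRight ⌊z 1⌋).tsum_eq c

theorem exists_integral_inv_weight_le (g : EuclideanSpace ℝ (Fin 2) → ℝ)
    (hgu : ∃ M : ℝ, ∀ k : Fin 2 → ℤ,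
      ∫⁻ x in unitSquare k, ENNReal.ofReal (g x ^ 2) ≤ ENNReal.ofReal M)
    (hg : Measurable g) :
    ∃ K : ℝ, ∀ z, Integrable (fun y => ((1 + ‖z - y‖ ^ 2) ^ 2)⁻¹ * g y ^ 2) ∧
      ∫ y, ((1 + ‖z - y‖ ^ 2) ^ 2)⁻¹ * g y ^ 2 ≤ K := by
  obtain ⟨K, hK, h⟩ := exists_lintegral_inv_weight_le g hgu hg
  refine ⟨K.toReal, fun z => ?_⟩
  have hm : Measurable fun y => ((1 + ‖z - y‖ ^ 2) ^ 2)⁻¹ * g y ^ 2 := by fun_prop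
  have h0 : ∀ y, 0 ≤ ((1 + ‖z - y‖ ^ 2) ^ 2)⁻¹ * g y ^ 2 := fun y => by positivity
  refine ⟨⟨hm.aestronglyMeasurable, ?_⟩, ?_⟩
  · rw [hasFiniteIntegral_iff_ofReal (.of_forall h0)]
    exact (h z).trans_lt hK.lt_top
  · rw [integral_eq_lintegral_of_nonneg_ae (.of_forall h0) hm.aestronglyMeasurable]
    exact ENNReal.toReal_mono hK (h z)

section vconv

variable {V : Type*} [NormedAddCommGroup V] [NormedSpace ℝ V]
  {g : EuclideanSpace ℝ (Fin 2) → ℝ} {r : EuclideanSpace ℝ (Fin 2) → V}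

theorem exists_integral_norm_smul_le (hg : Measurable g)
    (hgu : ∃ M : ℝ, ∀ k : Fin 2 → ℤ,
      ∫⁻ x in unitSquare k, ENNReal.ofReal (g x ^ 2) ≤ ENNReal.ofReal M)
    (hr : Continuous r) (hw : WeightedSq r) :
    ∃ C : ℝ, 0 ≤ C ∧ ∀ z, Integrable (fun y => g y • r (z - y)) ∧
      ∫ y, ‖g y • r (z - y)‖ ≤ C := by
  obtain ⟨K, hK⟩ := exists_integral_inv_weight_le g hgu hg
  have hb : ∀ z y, ‖g y • r (z - y)‖ ≤
      (1 + ‖z - y‖ ^ 2) ^ 2 * ‖r (z - y)‖ ^ 2 + ((1 + ‖z - y‖ ^ 2) ^ 2)⁻¹ * g y ^ 2 := by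
    intro z y
    rw [norm_smul, ← sq_abs (g y), ← Real.norm_eq_abs]
    set w := 1 + ‖z - y‖ ^ 2
    have hw : 0 < w := by positivity
    have h1 : w * w⁻¹ = 1 := mul_inv_cancel₀ hw.ne'
    have h2 : (w * ‖r (z - y)‖) * (w⁻¹ * ‖g y‖) = ‖g y‖ * ‖r (z - y)‖ := by
      linear_combination (‖g y‖ * ‖r (z - y)‖) * h1
    have h3 : 0 ≤ (w * ‖r (z - y)‖) * (w⁻¹ * ‖g y‖) := by positivity
    rw [← h2, ← inv_pow, ← mul_pow, ← mul_pow]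
    nlinarith [sq_nonneg (w * ‖r (z - y)‖ - w⁻¹ * ‖g y‖)]
  have hi : ∀ z, Integrable fun y => (1 + ‖z - y‖ ^ 2) ^ 2 * ‖r (z - y)‖ ^ 2 :=
    fun z => hw.comp_sub_left z
  have hint : ∀ z, Integrable (fun y => g y • r (z - y)) := fun z =>
    ((hi z).add (hK z).1).mono' (hg.aestronglyMeasurable.smul
      (by fun_prop : Continuous fun y => r (z - y)).aestronglyMeasurable) (.of_forall (hb z))
  have hle : ∀ z, ∫ y, ‖g y • r (z - y)‖ ≤
      (∫ y, (1 + ‖y‖ ^ 2) ^ 2 * ‖r y‖ ^ 2) + K := fun z => by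
    calc _ ≤ ∫ y, ((1 + ‖z - y‖ ^ 2) ^ 2 * ‖r (z - y)‖ ^ 2 +
          ((1 + ‖z - y‖ ^ 2) ^ 2)⁻¹ * g y ^ 2) :=
          integral_mono (hint z).norm ((hi z).add (hK z).1) (hb z)
      _ = _ := integral_add (hi z) (hK z).1
      _ ≤ _ := by
        refine add_le_add (le_of_eq ?_) (hK z).2
        exact integral_sub_left_eq_self (fun y => (1 + ‖y‖ ^ 2) ^ 2 * ‖r y‖ ^ 2) volume z
  exact ⟨_, (integral_nonneg fun _ => norm_nonneg _).trans (hle 0), fun z => ⟨hint z, hle z⟩⟩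

theorem exists_norm_vconv_le (hg : Measurable g)
    (hgu : ∃ M : ℝ, ∀ k : Fin 2 → ℤ,
      ∫⁻ x in unitSquare k, ENNReal.ofReal (g x ^ 2) ≤ ENNReal.ofReal M)
    (hr : Continuous r) (hw : WeightedSq r) :
    ∃ C : ℝ, ∀ z, ‖vconv g r z‖ ≤ C := by
  obtain ⟨C, -, hC⟩ := exists_integral_norm_smul_le hg hgu hr hw
  exact ⟨C, fun z => (norm_integral_le_integral_norm _).trans (hC z).2⟩

theorem vconv_add_sub_vconv [CompleteSpace V] (hg : Measurable g)
    (hgu : ∃ M : ℝ, ∀ k : Fin 2 → ℤ,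
      ∫⁻ x in unitSquare k, ENNReal.ofReal (g x ^ 2) ≤ ENNReal.ofReal M)
    (hr : ContDiff ℝ 1 r) (hw : WeightedSq r) (hw' : WeightedSq (fderiv ℝ r))
    (x h : EuclideanSpace ℝ (Fin 2)) :
    vconv g r (x + h) - vconv g r x =
      ∫ t in (0 : ℝ)..1, vconv g (fderiv ℝ r) (x + t • h) h := by
  have hc' : Continuous (fderiv ℝ r) := hr.continuous_fderiv one_ne_zero
  obtain ⟨C, -, hC⟩ := exists_integral_norm_smul_le hg hgu hr.continuous hw
  obtain ⟨C', -, hC'⟩ := exists_integral_norm_smul_le hg hgu hc' hw'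
  have hline : ∀ y, r (x + h - y) - r (x - y) =
      ∫ t in (0 : ℝ)..1, fderiv ℝ r (x + t • h - y) h := by
    intro y
    have hd : ∀ t : ℝ, HasDerivAt (fun t : ℝ => r (x + t • h - y))
        (fderiv ℝ r (x + t • h - y) h) t := by
      intro t
      have h1 : HasDerivAt (fun t : ℝ => x + t • h - y) h t := by
        simpa using (((hasDerivAt_id t).smul_const h).const_add x).sub_const y
      exact ((hr.differentiable one_ne_zero _).hasFDerivAt).comp_hasDerivAt t h1
    rw [intervalIntegral.integral_eq_sub_of_hasDerivAt (fun t _ => hd t)]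
    · simp
    · exact (by fun_prop : Continuous fun t : ℝ =>
        fderiv ℝ r (x + t • h - y) h).intervalIntegrable _ _
  have happ : ∀ t : ℝ, vconv g (fderiv ℝ r) (x + t • h) h =
      ∫ y, g y • fderiv ℝ r (x + t • h - y) h := fun t =>
    ContinuousLinearMap.integral_apply (hC' _).1 h
  have hmeas : AEStronglyMeasurable
      (Function.uncurry fun (t : ℝ) y => g y • fderiv ℝ r (x + t • h - y) h)
      ((volume.restrict (Set.uIoc (0 : ℝ) 1)).prod volume) := by
    refine AEStronglyMeasurable.smul (hg.comp measurable_snd).aestronglyMeasurable ?_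
    exact (by fun_prop : Continuous fun p : ℝ × EuclideanSpace ℝ (Fin 2) =>
      fderiv ℝ r (x + p.1 • h - p.2) h).aestronglyMeasurable
  have hsec : ∀ t : ℝ, Integrable fun y => g y • fderiv ℝ r (x + t • h - y) h := fun t =>
    (hC' (x + t • h)).1.apply_continuousLinearMap h
  have hint : Integrable
      (Function.uncurry fun (t : ℝ) y => g y • fderiv ℝ r (x + t • h - y) h)
      ((volume.restrict (Set.uIoc (0 : ℝ) 1)).prod volume) := by
    rw [integrable_prod_iff hmeas]
    refine ⟨.of_forall hsec, ?_⟩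
    have : IsFiniteMeasure (volume.restrict (Set.uIoc (0 : ℝ) 1)) := by
      rw [Set.uIoc_of_le zero_le_one]; infer_instance
    refine (integrable_const (C' * ‖h‖)).mono' hmeas.norm.integral_prod_right'
      (.of_forall fun t => ?_)
    rw [Real.norm_of_nonneg (integral_nonneg fun _ => norm_nonneg _)]
    calc _ ≤ ∫ y, ‖g y • fderiv ℝ r (x + t • h - y)‖ * ‖h‖ := by
          refine integral_mono (hsec t).norm ((hC' _).1.norm.mul_const _) fun y => ?_
          exact (g y • fderiv ℝ r (x + t • h - y)).le_opNorm h
      _ = (∫ y, ‖g y • fderiv ℝ r (x + t • h - y)‖) * ‖h‖ := integral_mul_const _ _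
      _ ≤ _ := by gcongr; exact (hC' _).2
  simp_rw [happ]
  rw [intervalIntegral_integral_swap hint, vconv, vconv, ← integral_sub (hC _).1 (hC _).1]
  refine integral_congr_ae (.of_forall fun y => ?_)
  simp only
  rw [← smul_sub, hline, intervalIntegral.integral_smul]

theorem exists_norm_vconv_sub_le [CompleteSpace V] (hg : Measurable g)
    (hgu : ∃ M : ℝ, ∀ k : Fin 2 → ℤ,
      ∫⁻ x in unitSquare k, ENNReal.ofReal (g x ^ 2) ≤ ENNReal.ofReal M)
    (hr : ContDiff ℝ 1 r) (hw : WeightedSq r) (hw' : WeightedSq (fderiv ℝ r)) :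
    ∃ L : ℝ, 0 ≤ L ∧ ∀ x h, ‖vconv g r (x + h) - vconv g r x‖ ≤ L * ‖h‖ := by
  obtain ⟨C, hC⟩ := exists_norm_vconv_le hg hgu (hr.continuous_fderiv one_ne_zero) hw'
  refine ⟨C, (norm_nonneg _).trans (hC 0), fun x h => ?_⟩
  rw [vconv_add_sub_vconv hg hgu hr hw hw']
  refine (intervalIntegral.norm_integral_le_of_norm_le_const (C := C * ‖h‖) fun t _ => ?_).trans
    (by simp)
  exact ContinuousLinearMap.le_of_opNorm_le _ (hC _) h

theorem hasFDerivAt_vconv [CompleteSpace V] (hg : Measurable g)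
    (hgu : ∃ M : ℝ, ∀ k : Fin 2 → ℤ,
      ∫⁻ x in unitSquare k, ENNReal.ofReal (g x ^ 2) ≤ ENNReal.ofReal M)
    (hr : ContDiff ℝ 2 r) (hw : WeightedSq r) (hw' : WeightedSq (fderiv ℝ r))
    (hw'' : WeightedSq (fderiv ℝ (fderiv ℝ r))) (x : EuclideanSpace ℝ (Fin 2)) :
    HasFDerivAt (vconv g r) (vconv g (fderiv ℝ r) x) x := by
  obtain ⟨L, hL0, hL⟩ := exists_norm_vconv_sub_le hg hgu
    (hr.fderiv_right (m := 1) (by norm_num)) hw' hw''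
  have hcont : Continuous (vconv g (fderiv ℝ r)) :=
    continuous_of_norm_add_sub_le hL0 hL
  rw [hasFDerivAt_iff_isLittleO_nhds_zero]
  refine Asymptotics.IsBigO.trans_isLittleO (g := fun h => ‖h‖ ^ 2) ?_ ?_
  · refine Asymptotics.IsBigO.of_bound L (.of_forall fun h => ?_)
    have hci : IntervalIntegrable (fun t : ℝ => vconv g (fderiv ℝ r) (x + t • h) h)
      volume 0 1 := (by fun_prop : Continuous _).intervalIntegrable _ _
    have : vconv g (fderiv ℝ r) x h = ∫ _ in (0 : ℝ)..1, vconv g (fderiv ℝ r) x h := by simp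
    rw [vconv_add_sub_vconv hg hgu (hr.of_le (by norm_num)) hw hw', this,
      ← intervalIntegral.integral_sub hci (by simp)]
    refine (intervalIntegral.norm_integral_le_of_norm_le_const (C := L * ‖h‖ ^ 2)
      fun t ht => ?_).trans (by simp)
    rw [Set.uIoc_of_le zero_le_one] at ht
    rw [← sub_apply]
    refine (ContinuousLinearMap.le_of_opNorm_le _ (hL x (t • h)) h).trans ?_
    rw [norm_smul, Real.norm_of_nonneg ht.1.le]
    nlinarith [mul_nonneg (mul_nonneg hL0 (sq_nonneg ‖h‖)) (sub_nonneg.2 ht.2)]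
  · exact (Asymptotics.isLittleO_norm_pow_id one_lt_two)

end vconv

theorem measurable_gam (i j : Fin 2) : Measurable (gam i j) := by
  unfold gam
  have h : ∀ i : Fin 2, Measurable fun z : EuclideanSpace ℝ (Fin 2) => z i := fun i =>
    (by fun_prop : Continuous fun z : EuclideanSpace ℝ (Fin 2) => z i).measurable
  exact (measurable_const.div (by fun_prop)).sub
    (((measurable_const.mul (h i)).mul (h j)).div (by fun_prop))

theorem abs_gam_le (i j : Fin 2) (z : EuclideanSpace ℝ (Fin 2)) :
    |gam i j z| ≤ 4 / ‖z‖ ^ 3 := by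
  rcases eq_or_ne z 0 with rfl | hz
  · simp [gam]
  have hz' : 0 < ‖z‖ := norm_pos_iff.2 hz
  have hi : |z i| ≤ ‖z‖ := PiLp.norm_apply_le z i
  have hj : |z j| ≤ ‖z‖ := PiLp.norm_apply_le z j
  have h1 : |(if i = j then (1 : ℝ) else 0) / ‖z‖ ^ 3| ≤ 1 / ‖z‖ ^ 3 := by
    rw [abs_div, abs_of_pos (pow_pos hz' 3)]
    gcongr
    split_ifs <;> simp
  have h2 : |3 * z i * z j / ‖z‖ ^ 5| ≤ 3 / ‖z‖ ^ 3 := by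
    rw [abs_div, abs_of_pos (pow_pos hz' 5), abs_mul, abs_mul,
      abs_of_pos (by norm_num : (0 : ℝ) < 3),
      div_le_div_iff₀ (by positivity) (by positivity)]
    calc 3 * |z i| * |z j| * ‖z‖ ^ 3 ≤ 3 * ‖z‖ * ‖z‖ * ‖z‖ ^ 3 := by gcongr
      _ = _ := by ring
  calc _ ≤ 1 / ‖z‖ ^ 3 + 3 / ‖z‖ ^ 3 := (abs_sub _ _).trans (add_le_add h1 h2)
    _ = _ := by ring

/-- The radial majorant `min (‖z‖⁻¹) (‖z‖⁻³)` of the regularised singular integrand. -/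
noncomputable def majorant (s : ℝ) : ℝ := if s ≤ 1 then s⁻¹ else (s ^ 3)⁻¹

theorem integrable_majorant_norm :
    Integrable fun z : EuclideanSpace ℝ (Fin 2) => majorant ‖z‖ := by
  rw [integrable_fun_norm_addHaar (μ := volume) (f := majorant), finrank_euclideanSpace_fin,
    ← Set.Ioc_union_Ioi_eq_Ioi zero_le_one]
  refine IntegrableOn.union ?_ ?_
  · refine (integrableOn_const (C := (1 : ℝ)) (by simp)).congr_fun (fun s hs => ?_)
      measurableSet_Ioc
    simp [majorant, hs.2, hs.1.ne']
  · refine (integrableOn_Ioi_rpow_of_lt (by norm_num : (-2 : ℝ) < -1) one_pos).congr_fun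
      (fun s hs => ?_) measurableSet_Ioi
    have hs' : (1 : ℝ) < s := hs
    have h0 : s ≠ 0 := by positivity
    simp only [majorant, not_le.2 hs', if_false, smul_eq_mul]
    rw [Real.rpow_neg (by positivity), Real.rpow_two]
    simp only [Nat.add_one_sub_one, pow_one]
    field_simp

/-- The difference `f(x) - f(x - z)` with its linear part `f'(x) z` removed for `‖z‖ ≤ 1`. -/
noncomputable def taylorDiff (f : EuclideanSpace ℝ (Fin 2) → ℝ)
    (f' : EuclideanSpace ℝ (Fin 2) → EuclideanSpace ℝ (Fin 2) →L[ℝ] ℝ)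
    (x z : EuclideanSpace ℝ (Fin 2)) : ℝ :=
  f x - f (x - z) - if ‖z‖ ≤ 1 then f' x z else 0

theorem Iop_eq_integral_taylorDiff (i j : Fin 2) {f : EuclideanSpace ℝ (Fin 2) → ℝ}
    {f' : EuclideanSpace ℝ (Fin 2) → EuclideanSpace ℝ (Fin 2) →L[ℝ] ℝ}
    (hf : ∀ x, HasFDerivAt f (f' x) x) (x : EuclideanSpace ℝ (Fin 2)) :
    Iop i j f x = ∫ z, gam i j z * taylorDiff f f' x z := by
  rw [← integral_sub_left_eq_self (fun z => gam i j z * taylorDiff f f' x z) volume x]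
  simp [Iop, taylorDiff, (hf x).fderiv]

theorem exists_gam_mul_taylorDiff_le (i j : Fin 2) {f : EuclideanSpace ℝ (Fin 2) → ℝ}
    {f' : EuclideanSpace ℝ (Fin 2) → EuclideanSpace ℝ (Fin 2) →L[ℝ] ℝ}
    (hf : ∀ x, HasFDerivAt f (f' x) x) {A L : ℝ} (hA : ∀ x, |f x| ≤ A) (hL0 : 0 ≤ L)
    (hL : ∀ x h, ‖f' (x + h) - f' x‖ ≤ L * ‖h‖) :
    ∃ C, ∀ x z, ‖gam i j z * taylorDiff f f' x z‖ ≤ C * majorant ‖z‖ := by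
  have hA0 : 0 ≤ A := (abs_nonneg _).trans (hA 0)
  refine ⟨4 * (2 * A + L), fun x z => ?_⟩
  rw [norm_mul, Real.norm_eq_abs]
  by_cases hz : ‖z‖ ≤ 1
  · have hT : ‖taylorDiff f f' x z‖ ≤ L * ‖z‖ * ‖z‖ := by
      have := (convex_closedBall x ‖z‖).norm_image_sub_le_of_norm_hasFDerivWithin_le'
        (f := f) (f' := f') (φ := f' x) (C := L * ‖z‖) (x := x) (y := x - z)
        (fun y _ => (hf y).hasFDerivWithinAt)
        (fun y hy => by
          have h1 := hL x (y - x)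
          rw [add_sub_cancel] at h1
          refine h1.trans ?_
          gcongr
          rwa [← dist_eq_norm, ← Metric.mem_closedBall])
        (by simp) (by simp)
      rw [taylorDiff, if_pos hz, ← norm_neg]
      simp only [sub_sub_cancel_left, map_neg, norm_neg] at this
      rwa [show -(f x - f (x - z) - f' x z) = f (x - z) - f x - -f' x z by ring]
    rw [majorant, if_pos hz]
    rcases eq_or_ne z 0 with rfl | h0
    · simp [taylorDiff]
    have hz' : 0 < ‖z‖ := norm_pos_iff.2 h0
    calc _ ≤ 4 / ‖z‖ ^ 3 * (L * ‖z‖ * ‖z‖) := by gcongr; exact abs_gam_le i j z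
      _ = 4 * L * ‖z‖⁻¹ := by field_simp
      _ ≤ _ := by gcongr; linarith
  · have hT : ‖taylorDiff f f' x z‖ ≤ 2 * A := by
      rw [taylorDiff, if_neg hz, sub_zero, Real.norm_eq_abs]
      exact (abs_sub _ _).trans (by linarith [hA x, hA (x - z)])
    rw [majorant, if_neg hz]
    calc _ ≤ 4 / ‖z‖ ^ 3 * (2 * A) := by gcongr; exact abs_gam_le i j z
      _ = 4 * (2 * A) * (‖z‖ ^ 3)⁻¹ := by ring
      _ ≤ _ := by gcongr; linarith

theorem integral_mul_Iop_eq (i j : Fin 2) {f ψ : EuclideanSpace ℝ (Fin 2) → ℝ}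
    {f' : EuclideanSpace ℝ (Fin 2) → EuclideanSpace ℝ (Fin 2) →L[ℝ] ℝ}
    (hf : ∀ x, HasFDerivAt f (f' x) x) (hf' : Continuous f') {A L : ℝ}
    (hA : ∀ x, |f x| ≤ A) (hL0 : 0 ≤ L) (hL : ∀ x h, ‖f' (x + h) - f' x‖ ≤ L * ‖h‖)
    (hψ : Continuous ψ) (hψi : Integrable ψ) :
    ∫ x, ψ x * Iop i j f x = ∫ z, gam i j z * ∫ x, ψ x * taylorDiff f f' x z := by
  obtain ⟨C, hC⟩ := exists_gam_mul_taylorDiff_le i j hf hA hL0 hL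
  have hfc : Continuous f := continuous_iff_continuousAt.2 fun x => (hf x).continuousAt
  have hT : Measurable fun p : EuclideanSpace ℝ (Fin 2) × EuclideanSpace ℝ (Fin 2) =>
      taylorDiff f f' p.1 p.2 := by
    unfold taylorDiff
    refine Measurable.sub (by fun_prop) (Measurable.ite ?_ ?_ measurable_const)
    · exact (isClosed_le (by fun_prop) continuous_const).measurableSet
    · exact (by fun_prop : Continuous fun p : EuclideanSpace ℝ (Fin 2) ×
        EuclideanSpace ℝ (Fin 2) => f' p.1 p.2).measurable
  have hint : Integrable (Function.uncurry fun x z =>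
      ψ x * (gam i j z * taylorDiff f f' x z)) (volume.prod volume) := by
    refine (hψi.norm.mul_prod (integrable_majorant_norm.const_mul C)).mono'
      (Measurable.aestronglyMeasurable ?_) (.of_forall fun p => ?_)
    · exact (hψ.measurable.comp measurable_fst).mul
        (((measurable_gam i j).comp measurable_snd).mul hT)
    · simp only [Function.uncurry, norm_mul (ψ p.1)]
      gcongr
      exact hC _ _
  simp_rw [Iop_eq_integral_taylorDiff i j hf, ← integral_const_mul]
  rw [integral_integral_swap hint]
  simp_rw [mul_left_comm (ψ _)]

theorem integral_fderiv_mul_Iop (i j : Fin 2) {f φ : EuclideanSpace ℝ (Fin 2) → ℝ}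
    {f' : EuclideanSpace ℝ (Fin 2) → EuclideanSpace ℝ (Fin 2) →L[ℝ] ℝ}
    {f'' : EuclideanSpace ℝ (Fin 2) →
      EuclideanSpace ℝ (Fin 2) →L[ℝ] EuclideanSpace ℝ (Fin 2) →L[ℝ] ℝ}
    (hf : ∀ x, HasFDerivAt f (f' x) x) (hf' : ∀ x, HasFDerivAt f' (f'' x) x)
    {A A' L L' : ℝ} (hA : ∀ x, ‖f x‖ ≤ A) (hA' : ∀ x, ‖f' x‖ ≤ A')
    (hL0 : 0 ≤ L) (hL : ∀ x h, ‖f' (x + h) - f' x‖ ≤ L * ‖h‖)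
    (hL0' : 0 ≤ L') (hL' : ∀ x h, ‖f'' (x + h) - f'' x‖ ≤ L' * ‖h‖)
    (hφ : ContDiff ℝ 1 φ) (hφc : HasCompactSupport φ) (e : EuclideanSpace ℝ (Fin 2)) :
    ∫ x, fderiv ℝ φ x e * Iop i j f x = -∫ x, φ x * Iop i j (fun x => f' x e) x := by
  have hfc : Continuous f := continuous_iff_continuousAt.2 fun x => (hf x).continuousAt
  have hfc' : Continuous f' := continuous_iff_continuousAt.2 fun x => (hf' x).continuousAt
  have hfc'' : Continuous f'' :=
    continuous_of_norm_add_sub_le (f := f'') hL0' hL'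
  have hdφ : Continuous fun x => fderiv ℝ φ x e :=
    (hφ.continuous_fderiv one_ne_zero).clm_apply continuous_const
  have hdφc : HasCompactSupport fun x => fderiv ℝ φ x e := hφc.fderiv_apply ℝ e
  have hG : ∀ x, HasFDerivAt (fun x => f' x e) ((f'' x).flip e) x := fun x => by
    refine ((hf' x).clm_apply (hasFDerivAt_const e x)).congr_fderiv ?_
    ext v; simp
  have hGc : Continuous fun x => (f'' x).flip e := by
    have : Continuous fun x => (f'' x).flip :=
      (ContinuousLinearMap.flipₗᵢ ℝ (EuclideanSpace ℝ (Fin 2))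
        (EuclideanSpace ℝ (Fin 2)) ℝ).continuous.comp hfc''
    exact this.clm_apply continuous_const
  rw [integral_mul_Iop_eq i j hf hfc' hA hL0 hL hdφ (hdφ.integrable_of_hasCompactSupport hdφc),
    integral_mul_Iop_eq i j hG hGc (A := A' * ‖e‖) (L := L' * ‖e‖)
      (fun x => (f' x).le_of_opNorm_le (hA' x) e) (by positivity) ?_
      hφ.continuous (hφ.continuous.integrable_of_hasCompactSupport hφc), ← integral_neg]
  · refine integral_congr_ae (.of_forall fun z => ?_)
    simp only
    rw [← mul_neg]
    congr 1
    have hT : ∀ x, HasFDerivAt (fun x => taylorDiff f f' x z)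
        (f' x - f' (x - z) - if ‖z‖ ≤ 1 then (f'' x).flip z else 0) x := by
      intro x
      have h1 : HasFDerivAt (fun x => f (x - z)) (f' (x - z)) x := by
        exact (hf (x - z)).comp x ((hasFDerivAt_id x).sub_const z)
      unfold taylorDiff
      refine ((hf x).sub h1).sub ?_
      split_ifs
      · refine ((hf' x).clm_apply (hasFDerivAt_const z x)).congr_fderiv ?_
        ext v; simp
      · exact hasFDerivAt_const _ _
    have hTe : ∀ x, fderiv ℝ (fun x => taylorDiff f f' x z) x e =
        taylorDiff (fun x => f' x e) (fun x => (f'' x).flip e) x z := by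
      intro x
      rw [(hT x).fderiv, taylorDiff]
      split_ifs <;> simp [second_derivative_symmetric hf (hf' x) e z]
    have hTc : Continuous fun x => taylorDiff f f' x z :=
      continuous_iff_continuousAt.2 fun x => (hT x).continuousAt
    have hTc' : Continuous fun x =>
        taylorDiff (fun x => f' x e) (fun x => (f'' x).flip e) x z := by
      unfold taylorDiff
      split_ifs <;> fun_prop
    have := integral_mul_fderiv_eq_neg_fderiv_mul_of_integrable (μ := volume) (f := φ)
      (g := fun x => taylorDiff f f' x z) (v := e)
      ((hdφ.mul hTc).integrable_of_hasCompactSupport hdφc.mul_right)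
      (by
        simp_rw [hTe]
        exact (hφ.continuous.mul hTc').integrable_of_hasCompactSupport hφc.mul_right)
      ((hφ.continuous.mul hTc).integrable_of_hasCompactSupport hφc.mul_right)
      (fun x _ => hφ.differentiable one_ne_zero x) (fun x _ => (hT x).differentiableAt)
    simp_rw [hTe] at this
    rw [this, neg_neg]
  · intro x h
    have hflip : (f'' (x + h)).flip e - (f'' x).flip e = (f'' (x + h) - f'' x).flip e := by
      ext v; simp
    rw [hflip]
    refine ((f'' (x + h) - f'' x).flip.le_opNorm e).trans ?_
    rw [ContinuousLinearMap.opNorm_flip, mul_right_comm]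
    gcongr
    exact hL' x h

/-- Integration by parts: the distributional gradient of `I_1[ρ∗g]` is `I_1[∇ρ∗g]`. -/
theorem stmt10 (i j l : Fin 2) (g ρ φ : EuclideanSpace ℝ (Fin 2) → ℝ)
    (hg : Measurable g)
    (hgu : ∃ M : ℝ, ∀ k : Fin 2 → ℤ,
      ∫⁻ x in unitSquare k, ENNReal.ofReal (g x ^ 2) ≤ ENNReal.ofReal M)
    (hρ : ContDiff ℝ (⊤ : ℕ∞) ρ)
    (hρm : ∀ n : ℕ, n ≤ 3 →
      Integrable (fun y => (1 + ‖y‖ ^ 2) ^ 2 * ‖iteratedFDeriv ℝ n ρ y‖ ^ 2))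
    (hφ : ContDiff ℝ (⊤ : ℕ∞) φ) (hφc : HasCompactSupport φ) :
    ∫ x, fderiv ℝ φ x (EuclideanSpace.single l 1) *
        Iop i j (fun z => ∫ y, ρ (z - y) * g y) x
      = -∫ x, φ x *
          Iop i j (fun z => ∫ y, fderiv ℝ ρ (z - y) (EuclideanSpace.single l 1) * g y) x := by
  have h1 : ContDiff ℝ (⊤ : ℕ∞) (fderiv ℝ ρ) := hρ.fderiv_right (by simp)
  have h2 : ContDiff ℝ (⊤ : ℕ∞) (fderiv ℝ (fderiv ℝ ρ)) := h1.fderiv_right (by simp)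
  have w0 : WeightedSq ρ := by
    simpa only [WeightedSq, norm_iteratedFDeriv_zero] using hρm 0 (by norm_num)
  have w1 : WeightedSq (fderiv ℝ ρ) := by
    simpa only [WeightedSq, norm_iteratedFDeriv_one] using hρm 1 (by norm_num)
  have w2 := weightedSq_fderiv_fderiv (hρm 2 (by norm_num))
  have w3 := weightedSq_fderiv_fderiv (r := fderiv ℝ ρ) (by
    simpa only [norm_iteratedFDeriv_fderiv] using hρm 3 le_rfl)
  have le_top : ∀ n : ℕ, (n : WithTop ℕ∞) ≤ ((⊤ : ℕ∞) : WithTop ℕ∞) := fun n => by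
    exact_mod_cast le_top
  obtain ⟨A, hA⟩ := exists_norm_vconv_le hg hgu hρ.continuous w0
  obtain ⟨A', hA'⟩ := exists_norm_vconv_le hg hgu h1.continuous w1
  obtain ⟨L, hL0, hL⟩ := exists_norm_vconv_sub_le hg hgu (h1.of_le (le_top 1)) w1 w2
  obtain ⟨L', hL0', hL'⟩ := exists_norm_vconv_sub_le hg hgu (h2.of_le (le_top 1)) w2 w3
  obtain ⟨C, -, hC⟩ := exists_integral_norm_smul_le hg hgu h1.continuous w1
  have key := integral_fderiv_mul_Iop i j
    (fun x => hasFDerivAt_vconv hg hgu (hρ.of_le (le_top 2)) w0 w1 w2 x)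
    (fun x => hasFDerivAt_vconv hg hgu (h1.of_le (le_top 2)) w1 w2 w3 x)
    hA hA' hL0 hL hL0' hL' (hφ.of_le (le_top 1)) hφc (EuclideanSpace.single l 1)
  have e0 : (fun z => ∫ y, ρ (z - y) * g y) = vconv g ρ := by
    ext z; simp [vconv, mul_comm]
  have e1 : (fun z => ∫ y, fderiv ℝ ρ (z - y) (EuclideanSpace.single l 1) * g y) =
      fun z => vconv g (fderiv ℝ ρ) z (EuclideanSpace.single l 1) := by
    ext z
    rw [vconv, ContinuousLinearMap.integral_apply (hC z).1]
    simp [mul_comm]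
  rw [e0, e1]
  exact key
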